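/- (Equation (4.1).) Let λ^1,…,λ^r be partitions, let π ∈ 𝒫([r]) be a set partition of [r], and let σ be any filling of λ^{[r]} with positive integer entries. Then maj(σ) = Σ_{B∈π} maj(σ^B), where σ^B is the filling of λ^B induced from σ by the coloring identification of boxes. -/

import Mathlib

open Finset

open scoped Classical

noncomputable section

/-! ### Set partitions -/

/-- `π` is a set partition of the finite set `H`. -/
def IsSetPartition {α : Type*} (π : Finset (Finset α)) (H : Finset α) : Prop :=
  (∀ B ∈ π, B ⊆ H) ∧ (∀ B ∈ π, B.Nonempty) ∧
    (∀ B ∈ π, ∀ C ∈ π, B ≠ C → Disjoint B C) ∧ (∀ a ∈ H, ∃ B ∈ π, a ∈ B)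

/-- The finite set of all set partitions of `H`. -/
def setPartitions {α : Type*} (H : Finset α) : Finset (Finset (Finset α)) :=
  H.powerset.powerset.filter (fun π => IsSetPartition π H)

/-- The joint cumulant of the family `u` on the subset `H`. -/
def jointCumulant {A : Type*} [CommRing A] {ι : Type*} (u : Finset ι → A) (H : Finset ι) : A :=
  ∑ π ∈ setPartitions H,
    (-1 : A) ^ (π.card - 1) * ((π.card - 1).factorial : A) * ∏ B ∈ π, u B

/-! ### Multigraphs -/

/-- Number of edges of the multigraph with endpoint map `ends` whose endpoint set is `{i,j}`. -/
def eCnt {V E : Type*} [Fintype E] (ends : E → Sym2 V) (i j : V) : ℕ :=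
  (univ.filter fun e => ends e = s(i, j)).card

/-- The spanning subgraph `(V, S)` is connected. -/
def SConnected {V E : Type*} (ends : E → Sym2 V) (S : Finset E) : Prop :=
  ∀ v w : V, Relation.ReflTransGen (fun a b => ∃ e ∈ S, ends e = s(a, b)) v w

/-- The subgraph `(B, S)` is connected. -/
def SConnectedOn {V E : Type*} (ends : E → Sym2 V) (B : Finset V) (S : Finset E) : Prop :=
  ∀ v ∈ B, ∀ w ∈ B, Relation.ReflTransGen (fun a b => ∃ e ∈ S, ends e = s(a, b)) v w

/-- `E|_B`: the edges with both endpoints in `B`. -/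
def edgesIn {V E : Type*} [Fintype E] (ends : E → Sym2 V) (B : Finset V) : Finset E :=
  univ.filter fun e => ∀ v ∈ ends e, v ∈ B

/-- `c_{G|_B}(q) = Σ_{S ⊆ E|_B, (B,S) connected} q^{#S}` as a polynomial in `q`. -/
def connPoly {V E : Type*} [Fintype E] (ends : E → Sym2 V) (B : Finset V) : Polynomial ℤ :=
  ∑ S ∈ (edgesIn ends B).powerset.filter (fun S => SConnectedOn ends B S),
    Polynomial.X ^ S.card

/-- Number of edges joining `w` to some vertex of `B`. -/
def dCnt {V E : Type*} [Fintype E] (ends : E → Sym2 V) (B : Finset V) (w : V) : ℕ :=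
  (univ.filter fun e => ∃ b ∈ B, ends e = s(w, b)).card

/-! ### The `G`-inversion polynomial -/

/-- `[m]_q = 1 + q + ⋯ + q^{m-1}`. -/
def nq {R : Type*} [CommSemiring R] (q : R) (m : ℕ) : R := ∑ k ∈ Finset.range m, q ^ k

/-- Rooted spanning trees (encoded by parent maps, rooted at `0`) of the simple graph `G̃`
underlying the multigraph on `Fin (r+1)` with edge multiplicities `e`. -/
def parentMaps {r : ℕ} (e : Fin (r+1) → Fin (r+1) → ℕ) : Finset (Fin (r+1) → Fin (r+1)) :=
  univ.filter fun p => p 0 = 0 ∧ (∀ w, w ≠ 0 → p w ≠ w ∧ 0 < e w (p w)) ∧ ∀ w, ∃ k, p^[k] w = 0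

/-- `(i,j)` is a `κ`-inversion of the spanning tree encoded by `p`. -/
def isKappaInv {r : ℕ} (e : Fin (r+1) → Fin (r+1) → ℕ) (p : Fin (r+1) → Fin (r+1))
    (i j : Fin (r+1)) : Prop :=
  i ≠ 0 ∧ j ≠ 0 ∧ i ≠ j ∧ (∃ k, p^[k] j = i) ∧ j < i ∧ p i ≠ j ∧ 0 < e j (p i)

/-- `κ(T) = Σ_{(i,j) κ-inversion} e_{parent(i), j}`. -/
def kappaStat {r : ℕ} (e : Fin (r+1) → Fin (r+1) → ℕ) (p : Fin (r+1) → Fin (r+1)) : ℕ :=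
  ∑ pr ∈ (univ ×ˢ univ : Finset (Fin (r+1) × Fin (r+1))).filter
    (fun pr => isKappaInv e p pr.1 pr.2), e (p pr.1) pr.2

/-- `δ_T(w) = Σ_u e_{u, parent(w)}`, `u` ranging over descendants of `w` together with `w`. -/
def deltaStat {r : ℕ} (e : Fin (r+1) → Fin (r+1) → ℕ) (p : Fin (r+1) → Fin (r+1))
    (w : Fin (r+1)) : ℕ :=
  ∑ u ∈ univ.filter (fun u => ∃ k, p^[k] u = w), e u (p w)

/-- The `G`-inversion polynomial `𝓘_G(q)` of the multigraph on `Fin (r+1)` with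
edge multiplicities `e`, evaluated at an element `q` of a commutative (semi)ring. -/
def Iinv {r : ℕ} {R : Type*} [CommSemiring R] (e : Fin (r+1) → Fin (r+1) → ℕ) (q : R) : R :=
  q ^ (∑ i, e i i) *
    ∑ p ∈ parentMaps e, q ^ kappaStat e p * ∏ w ∈ univ.erase (0 : Fin (r+1)), nq q (e w (p w))

/-! ### Partitions, Young diagrams and fillings -/

/-- `f : ℕ → ℕ` encodes a partition: `f j` is the `j`-th part (for `j ≥ 1`). -/
def IsPartitionFun (f : ℕ → ℕ) : Prop := Antitone f ∧ ∃ N, f N = 0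

/-- The number of (nonempty) rows of the diagram of `f`. -/
def nRows (f : ℕ → ℕ) : ℕ := sSup {j | f j ≠ 0}

/-- `λ^t_i`: the length of the `i`-th column of the diagram of `f`. -/
def colLen (f : ℕ → ℕ) (i : ℕ) : ℕ :=
  ((Finset.Icc 1 (nRows f)).filter (fun j => i ≤ f j)).card

/-- The cells `(i,j)`, `1 ≤ i ≤ f j`, `j ≥ 1`, of the Young diagram of `f`
(French convention, `i` the column index and `j` the row index). -/
def cells (f : ℕ → ℕ) : Finset (ℕ × ℕ) :=
  (Finset.Icc 1 (f 1) ×ˢ Finset.Icc 1 (nRows f)).filter (fun c => c.1 ≤ f c.2)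

/-- Fillings of the diagram of `f` with entries in `{1, …, N}`, encoded as functions
`ℕ × ℕ → ℕ` vanishing outside the diagram. -/
def fillings (f : ℕ → ℕ) (N : ℕ) : Finset ((ℕ × ℕ) → ℕ) :=
  ((cells f).pi (fun _ => Finset.Icc 1 N)).image
    (fun g c => if h : c ∈ cells f then g c h else 0)

/-- The descent set of a filling. -/
def desSet (f : ℕ → ℕ) (σ : (ℕ × ℕ) → ℕ) : Finset (ℕ × ℕ) :=
  (cells f).filter (fun c => 2 ≤ c.2 ∧ σ (c.1, c.2 - 1) < σ c)

/-- `maj(σ) = Σ_{□ ∈ Des(σ)} (leg(□) + 1)`. -/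
def majStat (f : ℕ → ℕ) (σ : (ℕ × ℕ) → ℕ) : ℕ :=
  ∑ c ∈ desSet f σ, (colLen f c.1 - c.2 + 1)

/-- The counterclockwise-increasing condition defining inversion pairs; the box below `c1`
is read via `σ`, which vanishes off the diagram (giving the convention `σ(□_3) = 0`). -/
def invTriple (σ : (ℕ × ℕ) → ℕ) (c1 c2 : ℕ × ℕ) : Prop :=
  (σ c1 ≤ σ (c1.1, c1.2 - 1) ∧ σ (c1.1, c1.2 - 1) < σ c2) ∨
  (σ (c1.1, c1.2 - 1) < σ c2 ∧ σ c2 < σ c1) ∨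
  (σ c2 < σ c1 ∧ σ c1 ≤ σ (c1.1, c1.2 - 1))

/-- The set of inversion pairs of a filling. -/
def invPairs (f : ℕ → ℕ) (σ : (ℕ × ℕ) → ℕ) : Finset ((ℕ × ℕ) × (ℕ × ℕ)) :=
  ((cells f) ×ˢ (cells f)).filter
    (fun pr => pr.1.2 = pr.2.2 ∧ pr.1.1 < pr.2.1 ∧ invTriple σ pr.1 pr.2)

/-- `inv(σ)`: the number of inversion pairs. -/
def invStat (f : ℕ → ℕ) (σ : (ℕ × ℕ) → ℕ) : ℕ := (invPairs f σ).card

/-! ### The ring `ℤ[q, t, x₁, x₂, …]` and Macdonald polynomials -/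

/-- The polynomial ring `ℤ[q, t, x₀, x₁, x₂, …]`. -/
abbrev MR : Type := MvPolynomial (Fin 2 ⊕ ℕ) ℤ

/-- The variable `q`. -/
def qv : MR := MvPolynomial.X (Sum.inl 0)

/-- The variable `t`. -/
def tv : MR := MvPolynomial.X (Sum.inl 1)

/-- The variable `x_k`. -/
def xv (k : ℕ) : MR := MvPolynomial.X (Sum.inr k)

/-- Haglund's formula: the modified Macdonald polynomial in the variables `x_1, …, x_N`. -/
def macH (f : ℕ → ℕ) (N : ℕ) : MR :=
  ∑ σ ∈ fillings f N, qv ^ invStat f σ * tv ^ majStat f σ * ∏ c ∈ cells f, xv (σ c)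

/-- `λ^B = ⊕_{b ∈ B} λ^b`. -/
def lamB {r : ℕ} (lam : Fin (r+1) → ℕ → ℕ) (B : Finset (Fin (r+1))) : ℕ → ℕ :=
  fun j => ∑ b ∈ B, lam b j

/-- The (unnormalized) Macdonald cumulant
`Σ_{π ∈ 𝒫([r])} (-1)^{#π-1} (#π-1)! Π_{B ∈ π} H̃_{λ^B}`. -/
def macCumulant {r : ℕ} (lam : Fin (r+1) → ℕ → ℕ) (N : ℕ) : MR :=
  ∑ π ∈ setPartitions (univ : Finset (Fin (r+1))),
    (-1 : MR) ^ (π.card - 1) * ((π.card - 1).factorial : MR) * ∏ B ∈ π, macH (lamB lam B) N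

/-! ### Coloring of the diagram `λ^B` -/

/-- Labels `(b, i)`, `b ∈ B`, `1 ≤ i ≤ λ^b_1`, of the columns of the diagrams `λ^b`, `b ∈ B`. -/
def columnPairs {r : ℕ} (lam : Fin (r+1) → ℕ → ℕ) (B : Finset (Fin (r+1))) :
    Finset (Fin (r+1) × ℕ) :=
  (B ×ˢ Finset.Icc 1 (lamB lam B 1)).filter (fun p => p.2 ≤ lam p.1 1)

/-- The column `p'` comes weakly before the column `p` in the sorted order
(longer first; ties first by color, then by column index). -/
def colBefore {r : ℕ} (lam : Fin (r+1) → ℕ → ℕ) (p' p : Fin (r+1) × ℕ) : Prop :=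
  colLen (lam p.1) p.2 < colLen (lam p'.1) p'.2 ∨
    (colLen (lam p'.1) p'.2 = colLen (lam p.1) p.2 ∧
      (p'.1 < p.1 ∨ (p'.1 = p.1 ∧ p'.2 ≤ p.2)))

/-- The position in `λ^B` of the column `i` of `λ^b`. -/
def posIn {r : ℕ} (lam : Fin (r+1) → ℕ → ℕ) (B : Finset (Fin (r+1)))
    (b : Fin (r+1)) (i : ℕ) : ℕ :=
  ((columnPairs lam B).filter (fun p' => colBefore lam p' (b, i))).card

/-- The label `(b, i)` of the column of `λ^B` at position `c`. -/
def colAt {r : ℕ} (lam : Fin (r+1) → ℕ → ℕ) (B : Finset (Fin (r+1))) (c : ℕ) :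
    Fin (r+1) × ℕ :=
  if h : ∃ p ∈ columnPairs lam B, posIn lam B p.1 p.2 = c then h.choose else (0, 1)

/-- The filling `σ^B` of `λ^B` induced from a filling `σ` of `λ^{[r]}` via the
identification of boxes given by the coloring. -/
def inducedFilling {r : ℕ} (lam : Fin (r+1) → ℕ → ℕ) (B : Finset (Fin (r+1)))
    (σ : (ℕ × ℕ) → ℕ) : (ℕ × ℕ) → ℕ :=
  fun cj =>
    if ∃ p ∈ columnPairs lam B, posIn lam B p.1 p.2 = cj.1 then
      σ (posIn lam univ (colAt lam B cj.1).1 (colAt lam B cj.1).2, cj.2)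
    else 0

/-- The color of the column `x` of `λ^{[r]}`. -/
def colColor {r : ℕ} (lam : Fin (r+1) → ℕ → ℕ) (x : ℕ) : Fin (r+1) :=
  (colAt lam univ x).1

/-- Edge multiplicities of the multigraph `G^σ`: the number of inversion pairs of `σ`
colored by `{i, j}`. -/
def eG {r : ℕ} (lam : Fin (r+1) → ℕ → ℕ) (σ : (ℕ × ℕ) → ℕ) (i j : Fin (r+1)) : ℕ :=
  ((invPairs (lamB lam univ) σ).filter (fun pr =>
    (colColor lam pr.1.1 = i ∧ colColor lam pr.2.1 = j) ∨
    (colColor lam pr.1.1 = j ∧ colColor lam pr.2.1 = i))).card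

/-- Edge multiplicities of the multigraph `G^{□_1,…,□_s}` attached to a set `D` of boxes:
for each box of `D` and each box strictly to its left in the same row, one edge joining
the colors of the two columns. -/
def eBox {r : ℕ} (lam : Fin (r+1) → ℕ → ℕ) (D : Finset (ℕ × ℕ)) (i j : Fin (r+1)) : ℕ :=
  ((D ×ˢ cells (lamB lam univ)).filter (fun pr =>
    pr.2.2 = pr.1.2 ∧ pr.2.1 < pr.1.1 ∧
      ((colColor lam pr.2.1 = i ∧ colColor lam pr.1.1 = j) ∨
       (colColor lam pr.2.1 = j ∧ colColor lam pr.1.1 = i)))).card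


/-! ### Columns of partitions -/

lemma IsPartitionFun.le_nRows {f : ℕ → ℕ} (hf : IsPartitionFun f) {j : ℕ} (h : f j ≠ 0) :
    j ≤ nRows f := by
  obtain ⟨N, hN⟩ := hf.2
  refine le_csSup ⟨N, fun k hk => ?_⟩ h
  by_contra! hlt
  have := hf.1 hlt.le
  simp only [Set.mem_ofPred_eq] at hk
  omega

/-- Column `i` reaches row `j` exactly when row `j` reaches column `i`. -/
lemma IsPartitionFun.le_colLen_iff {f : ℕ → ℕ} (hf : IsPartitionFun f) {i j : ℕ}
    (hi : 1 ≤ i) (hj : 1 ≤ j) : j ≤ colLen f i ↔ i ≤ f j := by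
  constructor
  · contrapose!
    intro h
    have hsub : (Icc 1 (nRows f)).filter (fun k => i ≤ f k) ⊆ Icc 1 (j - 1) := by
      intro k hk
      simp only [mem_filter, mem_Icc] at hk ⊢
      refine ⟨hk.1.1, ?_⟩
      by_contra hlt
      have := hf.1 (show j ≤ k by omega)
      omega
    have := card_le_card hsub
    rw [Nat.card_Icc] at this
    unfold colLen
    omega
  · intro h
    have hsub : Icc 1 j ⊆ (Icc 1 (nRows f)).filter (fun k => i ≤ f k) := by
      intro k hk
      simp only [mem_filter, mem_Icc] at hk ⊢
      have := hf.1 hk.2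
      exact ⟨⟨hk.1, hf.le_nRows (by omega)⟩, by omega⟩
    simpa [colLen] using card_le_card hsub

/-- The major index contribution of a column of length `n` with entries `s 1, …, s n`. -/
def columnMaj (n : ℕ) (s : ℕ → ℕ) : ℕ :=
  ∑ j ∈ (Icc 2 n).filter (fun j => s (j - 1) < s j), (n - j + 1)

lemma IsPartitionFun.majStat_eq_sum_columnMaj {f : ℕ → ℕ} (hf : IsPartitionFun f)
    (σ : ℕ × ℕ → ℕ) :
    majStat f σ = ∑ x ∈ Icc 1 (f 1), columnMaj (colLen f x) (fun j => σ (x, j)) := by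
  refine sum_finset_product _ _
    (fun x => (Icc 2 (colLen f x)).filter (fun j => σ (x, j - 1) < σ (x, j))) ?_
  rintro ⟨x, j⟩
  simp only [desSet, cells, mem_filter, mem_product, mem_Icc]
  constructor
  · rintro ⟨⟨⟨hx, hj⟩, hxj⟩, hj2, hlt⟩
    exact ⟨hx, ⟨hj2, (hf.le_colLen_iff hx.1 hj.1).2 hxj⟩, hlt⟩
  · rintro ⟨hx, ⟨hj2, hjl⟩, hlt⟩
    have hxj := (hf.le_colLen_iff hx.1 (by omega)).1 hjl
    exact ⟨⟨⟨hx, by omega, hf.le_nRows (by omega)⟩, hxj⟩, hj2, hlt⟩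

/-! ### Sorting the columns of the diagrams `λ^b` -/

section Columns

variable {r : ℕ} {lam : Fin (r+1) → ℕ → ℕ}

lemma isPartitionFun_lamB (hlam : ∀ b, IsPartitionFun (lam b)) (B : Finset (Fin (r+1))) :
    IsPartitionFun (lamB lam B) := by
  refine ⟨fun i j hij => sum_le_sum fun b _ => (hlam b).1 hij, ?_⟩
  choose N hN using fun b => (hlam b).2
  refine ⟨∑ b ∈ B, N b, sum_eq_zero fun b hb => ?_⟩
  have := (hlam b).1 (single_le_sum (f := N) (fun _ _ => Nat.zero_le _) hb)
  rw [hN] at this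
  omega

lemma mem_columnPairs {B : Finset (Fin (r+1))} {p : Fin (r+1) × ℕ} :
    p ∈ columnPairs lam B ↔ p.1 ∈ B ∧ 1 ≤ p.2 ∧ p.2 ≤ lam p.1 1 := by
  simp only [columnPairs, mem_filter, mem_product, mem_Icc]
  constructor
  · tauto
  · rintro ⟨h1, h2, h3⟩
    exact ⟨⟨h1, h2, h3.trans
      (single_le_sum (f := fun b => lam b 1) (fun _ _ => Nat.zero_le _) h1)⟩, h3⟩

lemma sum_columnPairs (B : Finset (Fin (r+1))) (F : Fin (r+1) × ℕ → ℕ) :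
    ∑ p ∈ columnPairs lam B, F p = ∑ b ∈ B, ∑ i ∈ Icc 1 (lam b 1), F (b, i) :=
  sum_finset_product _ _ (fun b => Icc 1 (lam b 1)) fun p => by
    rw [mem_columnPairs, mem_Icc]

lemma card_columnPairs (B : Finset (Fin (r+1))) : (columnPairs lam B).card = lamB lam B 1 := by
  rw [card_eq_sum_ones, sum_columnPairs]
  simp [lamB]

lemma card_filter_le_colLen (hlam : ∀ b, IsPartitionFun (lam b)) (B : Finset (Fin (r+1)))
    {j : ℕ} (hj : 1 ≤ j) :
    ((columnPairs lam B).filter (fun p => j ≤ colLen (lam p.1) p.2)).card = lamB lam B j := by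
  rw [card_filter, sum_columnPairs]
  refine sum_congr rfl fun b _ => ?_
  rw [← card_filter]
  have : (Icc 1 (lam b 1)).filter (fun i => j ≤ colLen (lam b) i) = Icc 1 (lam b j) := by
    ext i
    simp only [mem_filter, mem_Icc]
    constructor
    · rintro ⟨hi, h⟩
      exact ⟨hi.1, ((hlam b).le_colLen_iff hi.1 hj).1 h⟩
    · rintro ⟨hi, h⟩
      exact ⟨⟨hi, h.trans ((hlam b).1 hj)⟩, ((hlam b).le_colLen_iff hi hj).2 h⟩
  simp [this]

lemma colBefore_refl (p : Fin (r+1) × ℕ) : colBefore lam p p := by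
  simp [colBefore]

lemma colBefore_trans {p q s : Fin (r+1) × ℕ} (h : colBefore lam p q) (h' : colBefore lam q s) :
    colBefore lam p s := by
  simp only [colBefore, Fin.lt_def, Fin.ext_iff] at *
  omega

lemma colBefore_total (p q : Fin (r+1) × ℕ) : colBefore lam p q ∨ colBefore lam q p := by
  simp only [colBefore, Fin.lt_def, Fin.ext_iff]
  omega

lemma colBefore_antisymm {p q : Fin (r+1) × ℕ} (h : colBefore lam p q)
    (h' : colBefore lam q p) : p = q := by
  simp only [colBefore, Fin.lt_def, Prod.ext_iff, Fin.ext_iff] at *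
  omega

lemma colBefore_of_posIn_le {B : Finset (Fin (r+1))} {p q : Fin (r+1) × ℕ}
    (hp : p ∈ columnPairs lam B) (h : posIn lam B p.1 p.2 ≤ posIn lam B q.1 q.2) :
    colBefore lam p q := by
  rcases colBefore_total (lam := lam) p q with h1 | h1
  · exact h1
  have hsub : (columnPairs lam B).filter (fun s => colBefore lam s (q.1, q.2)) ⊆
      (columnPairs lam B).filter (fun s => colBefore lam s (p.1, p.2)) := by
    intro s hs
    rw [mem_filter] at hs ⊢
    exact ⟨hs.1, colBefore_trans hs.2 h1⟩
  have hmem : p ∈ (columnPairs lam B).filter (fun s => colBefore lam s (p.1, p.2)) :=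
    mem_filter.2 ⟨hp, colBefore_refl p⟩
  rw [← eq_of_subset_of_card_le hsub h] at hmem
  exact (mem_filter.1 hmem).2

lemma posIn_injOn (B : Finset (Fin (r+1))) :
    Set.InjOn (fun p : Fin (r+1) × ℕ => posIn lam B p.1 p.2) (columnPairs lam B) :=
  fun _ hp _ hq h =>
    colBefore_antisymm (colBefore_of_posIn_le hp (le_of_eq h))
      (colBefore_of_posIn_le hq (ge_of_eq h))

lemma image_posIn (B : Finset (Fin (r+1))) :
    (columnPairs lam B).image (fun p => posIn lam B p.1 p.2) = Icc 1 (lamB lam B 1) := by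
  refine eq_of_subset_of_card_le ?_ ?_
  · intro x hx
    obtain ⟨p, hp, rfl⟩ := mem_image.1 hx
    rw [mem_Icc]
    exact ⟨card_pos.2 ⟨p, mem_filter.2 ⟨hp, colBefore_refl p⟩⟩,
      (card_filter_le _ _).trans (card_columnPairs B).le⟩
  · rw [card_image_of_injOn (posIn_injOn B), card_columnPairs]
    simp

lemma posIn_le_lamB_iff (hlam : ∀ b, IsPartitionFun (lam b)) {B : Finset (Fin (r+1))}
    {p : Fin (r+1) × ℕ} (hp : p ∈ columnPairs lam B) {j : ℕ} (hj : 1 ≤ j) :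
    posIn lam B p.1 p.2 ≤ lamB lam B j ↔ j ≤ colLen (lam p.1) p.2 := by
  rw [← card_filter_le_colLen hlam B hj]
  constructor
  · contrapose!
    intro h
    refine card_lt_card (ssubset_iff_of_subset ?_ |>.2 ⟨p, ?_, ?_⟩)
    · intro q hq
      rw [mem_filter] at hq ⊢
      exact ⟨hq.1, Or.inl (h.trans_le hq.2)⟩
    · exact mem_filter.2 ⟨hp, colBefore_refl p⟩
    · simp [h]
  · intro h
    refine card_le_card fun q hq => ?_
    rw [mem_filter] at hq ⊢
    refine ⟨hq.1, h.trans ?_⟩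
    rcases hq.2 with h1 | h1
    · exact h1.le
    · exact h1.1.ge

/-- Sorting the columns preserves their lengths. -/
lemma colLen_lamB_posIn (hlam : ∀ b, IsPartitionFun (lam b)) {B : Finset (Fin (r+1))}
    {p : Fin (r+1) × ℕ} (hp : p ∈ columnPairs lam B) :
    colLen (lamB lam B) (posIn lam B p.1 p.2) = colLen (lam p.1) p.2 := by
  have hpos : 1 ≤ posIn lam B p.1 p.2 := card_pos.2 ⟨p, mem_filter.2 ⟨hp, colBefore_refl p⟩⟩
  have key : ∀ j, 1 ≤ j → (j ≤ colLen (lamB lam B) (posIn lam B p.1 p.2) ↔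
      j ≤ colLen (lam p.1) p.2) := fun j hj => by
    rw [(isPartitionFun_lamB hlam B).le_colLen_iff hpos hj, posIn_le_lamB_iff hlam hp hj]
  have h1 := key (colLen (lamB lam B) (posIn lam B p.1 p.2))
  have h2 := key (colLen (lam p.1) p.2)
  omega

lemma colAt_posIn {B : Finset (Fin (r+1))} {p : Fin (r+1) × ℕ} (hp : p ∈ columnPairs lam B) :
    colAt lam B (posIn lam B p.1 p.2) = p := by
  have h : ∃ q ∈ columnPairs lam B, posIn lam B q.1 q.2 = posIn lam B p.1 p.2 := ⟨p, hp, rfl⟩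
  rw [colAt, dif_pos h]
  exact posIn_injOn B h.choose_spec.1 hp h.choose_spec.2

lemma inducedFilling_posIn {B : Finset (Fin (r+1))} {p : Fin (r+1) × ℕ}
    (hp : p ∈ columnPairs lam B) (σ : ℕ × ℕ → ℕ) (j : ℕ) :
    inducedFilling lam B σ (posIn lam B p.1 p.2, j) = σ (posIn lam univ p.1 p.2, j) := by
  simp only [inducedFilling]
  rw [if_pos ⟨p, hp, rfl⟩, colAt_posIn hp]

lemma majStat_lamB (hlam : ∀ b, IsPartitionFun (lam b)) (B : Finset (Fin (r+1)))
    (σ : ℕ × ℕ → ℕ) :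
    majStat (lamB lam B) σ = ∑ p ∈ columnPairs lam B,
      columnMaj (colLen (lam p.1) p.2) (fun j => σ (posIn lam B p.1 p.2, j)) := by
  rw [(isPartitionFun_lamB hlam B).majStat_eq_sum_columnMaj, ← image_posIn,
    sum_image (posIn_injOn B)]
  exact sum_congr rfl fun p hp => by rw [colLen_lamB_posIn hlam hp]

end Columns

lemma sum_setPartition {α : Type*} {π : Finset (Finset α)} {H : Finset α}
    (hπ : π ∈ setPartitions H) (F : α → ℕ) : ∑ a ∈ H, F a = ∑ B ∈ π, ∑ a ∈ B, F a := by
  obtain ⟨hsub, -, hdisj, hcov⟩ := (mem_filter.1 hπ).2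
  have hH : H = π.biUnion id := by
    ext a
    simp only [mem_biUnion, id]
    exact ⟨hcov a, fun ⟨B, hB, ha⟩ => hsub B hB ha⟩
  rw [hH]
  exact sum_biUnion fun B hB C hC hne => hdisj B hB C hC hne

lemma sum_columnPairs_setPartition {r : ℕ} {lam : Fin (r+1) → ℕ → ℕ}
    {π : Finset (Finset (Fin (r+1)))} {H : Finset (Fin (r+1))} (hπ : π ∈ setPartitions H)
    (F : Fin (r+1) × ℕ → ℕ) :
    ∑ p ∈ columnPairs lam H, F p = ∑ B ∈ π, ∑ p ∈ columnPairs lam B, F p := by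
  rw [sum_columnPairs, sum_setPartition hπ]
  exact sum_congr rfl fun B _ => (sum_columnPairs B F).symm

/-- **Equation (4.1).** For any set partition `π` of `[r]` and any filling `σ` of
`λ^{[r]}` with positive integer entries, `maj(σ) = Σ_{B∈π} maj(σ^B)`. -/
theorem stmt9 {r : ℕ} (lam : Fin (r+1) → ℕ → ℕ) (hlam : ∀ b, IsPartitionFun (lam b))
    (π : Finset (Finset (Fin (r+1)))) (hπ : π ∈ setPartitions (univ : Finset (Fin (r+1))))
    (σ : (ℕ × ℕ) → ℕ)
    (hσ1 : ∀ c ∈ cells (lamB lam univ), 1 ≤ σ c)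
    (hσ0 : ∀ c, c ∉ cells (lamB lam univ) → σ c = 0) :
    majStat (lamB lam univ) σ = ∑ B ∈ π, majStat (lamB lam B) (inducedFilling lam B σ) := by
  rw [majStat_lamB hlam, sum_columnPairs_setPartition hπ]
  refine sum_congr rfl fun B _ => ?_
  rw [majStat_lamB hlam]
  refine sum_congr rfl fun p hp => ?_
  simp only [inducedFilling_posIn hp]

end
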